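/- arXiv:math/0605190 — 8 statements merged into one kernel-verified Lean document; each statement's English description precedes it below -/
import Mathlib

section
/- Let 𝒜 be an abelian category. Let V• be a cochain complex over 𝒜 concentrated in degrees 0 and 1 (so Vⁱ = 0 for i ∉ {0,1}), let V'• be a cochain complex with V'ⁱ = 0 for all i > 1, and let f : V'• → V• be a quasi-isomorphism. Then every cochain map from the mapping cone Cone(f) to V• is homotopic to zero; equivalently, Hom_{K(𝒜)}(Cone(f), V•) = 0. -/
open CategoryTheory CategoryTheory.Limits

/-- The mapping cone of a quasi-isomorphism is acyclic. -/
lemma acyclic_mappingCone_of_quasiIso {C : Type*} [Category* C] [Abelian C]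
    {K L : CochainComplex C ℤ} (f : K ⟶ L) [QuasiIso f] :
    (CochainComplex.mappingCone f).Acyclic := by
  rw [← HomotopyCategory.quotient_obj_mem_subcategoryAcyclic_iff_acyclic]
  refine ((HomotopyCategory.subcategoryAcyclic C).trW_iff_of_distinguished _
    (HomotopyCategory.mappingCone_triangleh_distinguished f)).1 ?_
  rw [← HomotopyCategory.quasiIso_eq_trW_subcategoryAcyclic]
  exact (HomotopyCategory.quotient_map_mem_quasiIso_iff f).2
    (by rwa [HomologicalComplex.mem_quasiIso_iff])

/-- A morphism from an acyclic complex vanishing in degree `2` to a complex concentrated in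
degrees `0` and `1` is homotopic to zero. -/
lemma nonempty_homotopy_zero_of_acyclic {C : Type*} [Category* C] [Abelian C]
    {K L : CochainComplex C ℤ} (hK : K.Acyclic) (hK₂ : IsZero (K.X 2))
    (hL : ∀ i : ℤ, i ≠ 0 → i ≠ 1 → IsZero (L.X i)) (g : K ⟶ L) :
    Nonempty (Homotopy g 0) := by
  have hex₁ : (K.sc' 0 1 2).Exact := (K.exactAt_iff' 0 1 2 (by simp) (by simp)).1 (hK 1)
  have hex₀ : (K.sc' (-1) 0 1).Exact := (K.exactAt_iff' (-1) 0 1 (by simp) (by simp)).1 (hK 0)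
  have hepi : Epi (K.d 0 1) := hex₁.epi_f (hK₂.eq_of_tgt _ _)
  have : Epi (K.sc' (-1) 0 1).g := hepi
  obtain ⟨s, hs⟩ : ∃ s : K.X 1 ⟶ L.X 0, K.d 0 1 ≫ s = g.f 0 :=
    hex₀.desc' (g.f 0) (by
      change K.d (-1) 0 ≫ g.f 0 = 0
      rw [← g.comm, (hL (-1) (by simp) (by simp)).eq_of_src (L.d (-1) 0) 0, comp_zero])
  have hs' : s ≫ L.d 0 1 = g.f 1 := by
    rw [← cancel_epi (K.d 0 1), reassoc_of% hs, g.comm]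
  refine ⟨⟨fun i j ↦ if h : i = 1 ∧ j = 0 then
    (K.XIsoOfEq h.1).hom ≫ s ≫ (L.XIsoOfEq h.2.symm).hom else 0, ?_, ?_⟩⟩
  · rintro i j hij
    refine dif_neg ?_
    rintro ⟨rfl, rfl⟩
    exact hij (by simp)
  · intro i
    by_cases h₀ : i = 0
    · subst h₀
      rw [dNext_eq _ (show (ComplexShape.up ℤ).Rel 0 1 by simp),
        prevD_eq _ (show (ComplexShape.up ℤ).Rel (-1) 0 by simp)]
      simp [hs]
    by_cases h₁ : i = 1
    · subst h₁
      rw [dNext_eq _ (show (ComplexShape.up ℤ).Rel 1 2 by simp),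
        prevD_eq _ (show (ComplexShape.up ℤ).Rel 0 1 by simp)]
      simp [hs']
    · exact (hL i h₀ h₁).eq_of_tgt _ _

/-- Every cochain map from the mapping cone of a quasi-isomorphism `f : V' ⟶ V`
(where `V` is concentrated in degrees 0 and 1, and `V'` vanishes in degrees `> 1`)
to `V` is homotopic to zero; equivalently `Hom_{K(A)}(Cone(f), V) = 0`. -/
theorem hom_from_mappingCone_homotopic_zero
    {A : Type u} [Category.{v} A] [Abelian A]
    (V V' : CochainComplex A ℤ)
    (hV : ∀ i : ℤ, i ≠ 0 → i ≠ 1 → IsZero (V.X i))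
    (hV' : ∀ i : ℤ, 1 < i → IsZero (V'.X i))
    (f : V' ⟶ V) [QuasiIso f]
    (g : CochainComplex.mappingCone f ⟶ V) :
    Nonempty (Homotopy g 0) :=
  nonempty_homotopy_zero_of_acyclic (acyclic_mappingCone_of_quasiIso f)
    ((CochainComplex.mappingCone.isZero_X_iff f 2).2
      ⟨hV' _ (by simp), hV 2 (by simp) (by simp)⟩) hV g
end

section
/- Let 𝒜 be an abelian category. Let V• be a cochain complex over 𝒜 concentrated in degrees 0 and 1, let V'• be a cochain complex with V'ⁱ = 0 for all i > 1, and let f : V'• → V• be a quasi-isomorphism. Then the map Hom_{K(𝒜)}(V•, V•) → Hom_{K(𝒜)}(V'•, V•) given by precomposition with f is injective. -/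
open CategoryTheory CategoryTheory.Limits

namespace CochainComplex

/-- A morphism from an acyclic complex vanishing in degrees `> 1` to a complex concentrated
in degrees `0` and `1` is null-homotopic. -/
theorem nonempty_homotopy_zero_of_acyclic
    {A : Type u} [Category.{v} A] [Abelian A] {C V : CochainComplex A ℤ}
    (hC : C.Acyclic) (hC' : ∀ i : ℤ, 1 < i → IsZero (C.X i))
    (hV : ∀ i : ℤ, i ≠ 0 → i ≠ 1 → IsZero (V.X i)) (k : C ⟶ V) :
    Nonempty (Homotopy k 0) := by
  have h₀ : (C.sc' (-1) 0 1).Exact :=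
    (C.exactAt_iff' (-1) 0 1 (by simp) (by simp)).1 (hC 0)
  have h₁ : (C.sc' 0 1 2).Exact :=
    (C.exactAt_iff' 0 1 2 (by simp) (by simp)).1 (hC 1)
  have : Epi (C.d 0 1) := h₁.epi_f ((hC' 2 (by lia)).eq_of_tgt _ _)
  have : Epi (C.sc' (-1) 0 1).g := this
  have hk : (C.sc' (-1) 0 1).f ≫ k.f 0 = 0 := by
    change C.d (-1) 0 ≫ k.f 0 = 0
    rw [← k.comm, (hV (-1) (by lia) (by lia)).eq_of_tgt (k.f (-1)) 0, zero_comp]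
  obtain ⟨t, ht⟩ : ∃ t : C.X 1 ⟶ V.X 0, C.d 0 1 ≫ t = k.f 0 :=
    ⟨h₀.desc _ hk, h₀.g_desc _ hk⟩
  have ht' : t ≫ V.d 0 1 = k.f 1 := by
    rw [← cancel_epi (C.d 0 1), ← Category.assoc, ht, k.comm]
  refine ⟨(HomComplex.Cochain.equivHomotopy _ _).symm ⟨HomComplex.Cochain.single t (-1), ?_⟩⟩
  rw [HomComplex.Cochain.δ_single t (-1) 0 (by lia) 0 1 (by lia) (by lia), ht, ht']
  ext i
  by_cases hi₀ : i = 0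
  · subst hi₀
    simp [HomComplex.Cochain.single_v, HomComplex.Cochain.single_v_eq_zero]
  by_cases hi₁ : i = 1
  · subst hi₁
    simp [HomComplex.Cochain.single_v, HomComplex.Cochain.single_v_eq_zero]
  exact (hV i hi₀ hi₁).eq_of_tgt _ _

/-- The mapping cone of a quasi-isomorphism is acyclic. -/
theorem acyclic_mappingCone_of_quasiIso
    {A : Type u} [Category.{v} A] [Abelian A] {K L : CochainComplex A ℤ}
    (f : K ⟶ L) [QuasiIso f] : (mappingCone f).Acyclic := by
  rw [← HomotopyCategory.quotient_obj_mem_subcategoryAcyclic_iff_acyclic]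
  have hf : (HomotopyCategory.subcategoryAcyclic A).trW
      ((HomotopyCategory.quotient A (ComplexShape.up ℤ)).map f) := by
    rw [← HomotopyCategory.quasiIso_eq_trW_subcategoryAcyclic,
      HomotopyCategory.quotient_map_mem_quasiIso_iff]
    simpa [HomologicalComplex.mem_quasiIso_iff]
  exact ((HomotopyCategory.subcategoryAcyclic A).trW_iff_of_distinguished _
    (HomotopyCategory.mappingCone_triangleh_distinguished f)).1 hf

end CochainComplex

/-- For a quasi-isomorphism `f : V' ⟶ V` where `V` is concentrated in degrees 0 and 1
and `V'` vanishes in degrees `> 1`, precomposition with `f` gives an injection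
`Hom_{K(A)}(V, V) → Hom_{K(A)}(V', V)`. -/
theorem homotopyCategory_precomp_injective
    {A : Type u} [Category.{v} A] [Abelian A]
    (V V' : CochainComplex A ℤ)
    (hV : ∀ i : ℤ, i ≠ 0 → i ≠ 1 → IsZero (V.X i))
    (hV' : ∀ i : ℤ, 1 < i → IsZero (V'.X i))
    (f : V' ⟶ V) [QuasiIso f] :
    Function.Injective
      (fun g : (HomotopyCategory.quotient A (ComplexShape.up ℤ)).obj V ⟶
          (HomotopyCategory.quotient A (ComplexShape.up ℤ)).obj V =>
        (HomotopyCategory.quotient A (ComplexShape.up ℤ)).map f ≫ g) := by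
  intro g₁ g₂ hg
  obtain ⟨k, hk⟩ := Pretriangulated.Triangle.yoneda_exact₂ _
    (HomotopyCategory.mappingCone_triangleh_distinguished f) (g₁ - g₂)
    ((Preadditive.comp_sub _ _ _).trans (sub_eq_zero.2 hg))
  obtain ⟨k, rfl⟩ := (HomotopyCategory.quotient A (ComplexShape.up ℤ)).map_surjective k
  obtain ⟨h⟩ := CochainComplex.nonempty_homotopy_zero_of_acyclic
    (CochainComplex.acyclic_mappingCone_of_quasiIso f)
    (fun i hi => (CochainComplex.mappingCone.isZero_X_iff f i).2
      ⟨hV' _ (by lia), hV i (by lia) (by lia)⟩) hV k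
  have hk₀ : (HomotopyCategory.quotient A (ComplexShape.up ℤ)).map k = 0 :=
    (HomotopyCategory.eq_of_homotopy _ _ h).trans (Functor.map_zero _ _ _)
  exact sub_eq_zero.1 (hk.trans ((congrArg _ hk₀).trans comp_zero))
end

section
/- Let 𝒜 be an abelian category and let V• be a cochain complex over 𝒜 concentrated in degrees 0 and 1. Then the canonical map Hom_{K(𝒜)}(V•, V•) → Hom_{D(𝒜)}(V•, V•), induced by the localization functor from the homotopy category to the derived category, is injective. -/
open CategoryTheory CategoryTheory.Limits

/-- A morphism out of `K.X i` killed by `K.d h i` extends along `K.d i j` to the cycles of `K` in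
degree `j`, if `K` is exact in degrees `i` and `j`. -/
lemma HomologicalComplex.exists_toCycles_comp_eq
    {A : Type*} [Category* A] [Abelian A] {ι : Type*} {c : ComplexShape ι}
    (K : HomologicalComplex A c) {h i j : ι} (hi : c.prev i = h) (hj : c.next i = j)
    (hj' : c.prev j = i) (hKi : K.ExactAt i) (hKj : K.ExactAt j)
    {Y : A} (f : K.X i ⟶ Y) (hf : K.d h i ≫ f = 0) :
    ∃ g : K.cycles j ⟶ Y, K.toCycles i j ≫ g = f := by
  let S : ShortComplex A := ShortComplex.mk (K.d h i) (K.toCycles i j) (by simp)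
  let φ : S ⟶ K.sc' h i j :=
    { τ₁ := 𝟙 _
      τ₂ := 𝟙 _
      τ₃ := K.iCycles j
      comm₁₂ := (Category.id_comp _).trans (Category.comp_id _).symm
      comm₂₃ := (Category.id_comp _).trans (K.toCycles_i i j).symm }
  have : Epi φ.τ₁ := inferInstanceAs (Epi (𝟙 _))
  have : IsIso φ.τ₂ := inferInstanceAs (IsIso (𝟙 _))
  have : Mono φ.τ₃ := inferInstanceAs (Mono (K.iCycles j))
  have hS : S.Exact := by
    rw [ShortComplex.exact_iff_of_epi_of_isIso_of_mono φ]
    exact (K.exactAt_iff' h i j hi hj).1 hKi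
  have : Epi S.g := by
    subst hj'
    exact ((K.sc j).exact_iff_epi_toCycles).1 hKj
  exact ⟨hS.desc f hf, hS.g_desc f hf⟩

/-- A morphism from a complex in degrees `≤ 1` to a complex in degrees `≥ 0` which factors
through an acyclic complex is null-homotopic. -/
lemma CochainComplex.nonempty_homotopy_zero_of_acyclic_s2
    {A : Type*} [Category* A] [Abelian A] {V C V' : CochainComplex A ℤ}
    (hV : ∀ i : ℤ, 1 < i → IsZero (V.X i)) (hV' : ∀ i : ℤ, i < 0 → IsZero (V'.X i))
    (hC : ∀ n, C.ExactAt n) (a : V ⟶ C) (b : C ⟶ V') :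
    Nonempty (Homotopy (a ≫ b) 0) := by
  obtain ⟨g, hg⟩ := C.exists_toCycles_comp_eq (h := -1) (i := 0) (j := 1)
    (by simp) (by simp) (by simp) (hC 0) (hC 1) (b.f 0)
    (by rw [← b.comm]; simp [(hV' (-1) (by lia)).eq_of_tgt (b.f (-1)) 0])
  have hd : g ≫ V'.d 0 1 = C.iCycles 1 ≫ b.f 1 := by
    have : Epi (C.toCycles 0 1) := by
      have := ((C.sc 1).exact_iff_epi_toCycles).1 (hC 1)
      rwa [show (0 : ℤ) = (ComplexShape.up ℤ).prev 1 by simp]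
    rw [← cancel_epi (C.toCycles 0 1), reassoc_of% hg]
    simp
  let z : V.X 1 ⟶ C.cycles 1 := C.liftCycles (a.f 1) 2 (by simp)
    (by rw [a.comm, (hV 2 (by lia)).eq_of_src (a.f 2) 0, comp_zero])
  have hz : V.d 0 1 ≫ z = a.f 0 ≫ C.toCycles 0 1 := by
    rw [← cancel_mono (C.iCycles 1)]
    simp [z]
  let k : ∀ i j : ℤ, V.X i ⟶ V'.X j := fun i j =>
    if h : i = 1 ∧ j = 0 then
      (V.XIsoOfEq h.1).hom ≫ z ≫ g ≫ (V'.XIsoOfEq h.2).inv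
    else 0
  have hk : k 1 0 = z ≫ g := by simp [k]
  have hk' (i j : ℤ) (h : ¬ (i = 1 ∧ j = 0)) : k i j = 0 := dif_neg h
  refine ⟨{ hom := k, zero := fun i j hij => hk' i j ?_, comm := fun i => ?_ }⟩
  · rintro ⟨rfl, rfl⟩
    exact hij (by simp)
  · obtain hi | rfl | rfl | hi : i < 0 ∨ i = 0 ∨ i = 1 ∨ 1 < i := by lia
    · exact (hV' i hi).eq_of_tgt _ _
    · rw [dNext_eq k (i' := 1) (by simp), prevD_eq k (j' := -1) (by simp), hk,
        hk' 0 (-1) (by lia), reassoc_of% hz, hg]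
      simp
    · rw [dNext_eq k (i' := 2) (by simp), prevD_eq k (j' := 0) (by simp), hk,
        hk' 2 1 (by lia), Category.assoc, hd]
      simp [z]
    · exact (hV i hi).eq_of_src _ _

/-- The localization functor from the homotopy category to the derived category is injective on
morphisms from a complex in degrees `≤ 1` to a complex in degrees `≥ 0`. -/
lemma DerivedCategory.Qh_map_injective
    {A : Type u} [Category.{v} A] [Abelian A] [HasDerivedCategory.{w} A]
    {V V' : CochainComplex A ℤ}
    (hV : ∀ i : ℤ, 1 < i → IsZero (V.X i)) (hV' : ∀ i : ℤ, i < 0 → IsZero (V'.X i)) :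
    Function.Injective
      (fun g : (HomotopyCategory.quotient A (ComplexShape.up ℤ)).obj V ⟶
          (HomotopyCategory.quotient A (ComplexShape.up ℤ)).obj V' =>
        DerivedCategory.Qh.map g) := by
  intro f₁ f₂ hf
  obtain ⟨W, s, ⟨Z, p, q, hT, hZ⟩, hs⟩ := (MorphismProperty.map_eq_iff_precomp
    DerivedCategory.Qh (HomotopyCategory.subcategoryAcyclic A).trW f₁ f₂).1 hf
  obtain ⟨r, hr⟩ := Pretriangulated.Triangle.yoneda_exact₂ _ hT (f₁ - f₂)
    ((Preadditive.comp_sub _ _ _).trans (sub_eq_zero.2 hs))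
  obtain ⟨C, rfl⟩ := HomotopyCategory.quotient_obj_surjective Z
  obtain ⟨a, rfl⟩ := (HomotopyCategory.quotient A (ComplexShape.up ℤ)).map_surjective p
  obtain ⟨b, rfl⟩ := (HomotopyCategory.quotient A (ComplexShape.up ℤ)).map_surjective r
  rw [HomotopyCategory.quotient_obj_mem_subcategoryAcyclic_iff_exactAt] at hZ
  obtain ⟨H⟩ := CochainComplex.nonempty_homotopy_zero_of_acyclic_s2 hV hV' hZ a b
  have h := HomotopyCategory.eq_of_homotopy _ _ H
  rw [Functor.map_comp, Functor.map_zero] at h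
  exact sub_eq_zero.1 (hr.trans h)

/-- For a cochain complex `V` concentrated in degrees 0 and 1, the canonical map
`Hom_{K(A)}(V, V) → Hom_{D(A)}(V, V)` induced by the localization functor is injective. -/
theorem homotopyCategory_to_derivedCategory_injective
    {A : Type u} [Category.{v} A] [Abelian A] [HasDerivedCategory.{w} A]
    (V : CochainComplex A ℤ)
    (hV : ∀ i : ℤ, i ≠ 0 → i ≠ 1 → IsZero (V.X i)) :
    Function.Injective
      (fun g : (HomotopyCategory.quotient A (ComplexShape.up ℤ)).obj V ⟶
          (HomotopyCategory.quotient A (ComplexShape.up ℤ)).obj V =>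
        DerivedCategory.Qh.map g) :=
  DerivedCategory.Qh_map_injective (fun i hi => hV i (by lia) (by lia))
    (fun i hi => hV i (by lia) (by lia))
end

section
/- Let 𝒜 be an abelian category with enough projectives. Let V• : V₀ →^d V₁ be a cochain complex concentrated in degrees 0 and 1, and set A₀ := ker d = H⁰(V•) and A₁ := coker d = H¹(V•), with π : V₁ → A₁ the canonical projection. Assume that the map Hom(V₁, V₁) → Hom(V₁, A₁) given by postcomposition with π is bijective, and that Ext¹(V₁, A₀) = 0. Then the canonical map Hom_{K(𝒜)}(V•, V•) → Hom_{D(𝒜)}(V•, V•) induced by the localization functor is bijective. -/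
open CategoryTheory CategoryTheory.Limits

namespace DerivedCategory
open Pretriangulated

variable {C : Type*} [Category* C] [Abelian C] [HasDerivedCategory C]

/-- The localization functor is fully faithful on complexes homotopy equivalent to objects
placed in the same degree. -/
lemma Qh_map_bijective_of_iso_singleFunctor_obj {K L : HomotopyCategory C (.up ℤ)} (n : ℤ)
    {X Y : C} (e : K ≅ (HomotopyCategory.singleFunctor C n).obj X)
    (e' : L ≅ (HomotopyCategory.singleFunctor C n).obj Y) :
    Function.Bijective (Qh.map : (K ⟶ L) → (Qh.obj K ⟶ Qh.obj L)) := by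
  have hsingle (g : (HomotopyCategory.singleFunctor C n).obj X ⟶
      (HomotopyCategory.singleFunctor C n).obj Y) :
      ∃ x : X ⟶ Y, (HomotopyCategory.singleFunctor C n).map x = g := by
    obtain ⟨g, rfl⟩ := (HomotopyCategory.quotient C (.up ℤ)).map_surjective g
    obtain ⟨x, rfl⟩ := (CochainComplex.singleFunctor C n).map_surjective g
    exact ⟨x, rfl⟩
  constructor
  · intro g₁ g₂ h
    obtain ⟨x₁, hx₁⟩ := hsingle (e.inv ≫ g₁ ≫ e'.hom)
    obtain ⟨x₂, hx₂⟩ := hsingle (e.inv ≫ g₂ ≫ e'.hom)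
    have hx : x₁ = x₂ := (singleFunctor C n).map_injective (by
      change Qh.map ((HomotopyCategory.singleFunctor C n).map x₁) =
        Qh.map ((HomotopyCategory.singleFunctor C n).map x₂)
      rw [hx₁, hx₂]
      simp [h])
    rw [← cancel_mono e'.hom, ← cancel_epi e.inv, ← hx₁, ← hx₂, hx]
  · intro g
    obtain ⟨x, hx⟩ := (singleFunctor C n).map_surjective (Qh.map e.inv ≫ g ≫ Qh.map e'.hom)
    refine ⟨e.hom ≫ (HomotopyCategory.singleFunctor C n).map x ≫ e'.inv, ?_⟩
    have hx' : Qh.map ((HomotopyCategory.singleFunctor C n).map x) =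
      Qh.map e.inv ≫ g ≫ Qh.map e'.hom := hx
    rw [Functor.map_comp, Functor.map_comp, hx', Category.assoc, Category.assoc,
      ← Functor.map_comp, e'.hom_inv_id, CategoryTheory.Functor.map_id, Category.comp_id,
      ← Functor.map_comp_assoc, e.hom_inv_id, CategoryTheory.Functor.map_id, Category.id_comp]

lemma hom_eq_zero_of_homologyFunctor_map_eq_zero {X Y : DerivedCategory C} (n : ℤ)
    [X.IsGE n] [X.IsLE n] [Y.IsGE n] [Y.IsLE n] (f : X ⟶ Y)
    (hf : (homologyFunctor C n).map f = 0) : f = 0 := by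
  obtain ⟨X', ⟨e⟩⟩ := X.exists_iso_singleFunctor_obj_of_isGE_of_isLE n
  obtain ⟨Y', ⟨e'⟩⟩ := Y.exists_iso_singleFunctor_obj_of_isGE_of_isLE n
  obtain ⟨x, hx⟩ := (singleFunctor C n).map_surjective (e.inv ≫ f ≫ e'.hom)
  have hx0 : x = 0 := by
    have := NatIso.naturality_1 (singleFunctorCompHomologyFunctorIso C n) x
    dsimp at this
    rw [← this, hx]
    simp [hf]
  rw [← cancel_mono e'.hom, ← cancel_epi e.inv, ← hx, hx0]
  simp

/-- If `f : X ⟶ Y` is a morphism from an object concentrated in degree `0` to an object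
concentrated in degrees `[0, 1]` which is an isomorphism on `H⁰`, its cone is
concentrated in degree `1`. -/
lemma isGE_isLE_cone_of_isIso_homology_zero {X Y Z : DerivedCategory C} {f : X ⟶ Y}
    {g : Y ⟶ Z} {h : Z ⟶ X⟦(1 : ℤ)⟧} (hT : Triangle.mk f g h ∈ distTriang _)
    [X.IsGE 0] [X.IsLE 0] [Y.IsGE 0] [Y.IsLE 1] [IsIso ((homologyFunctor C 0).map f)] :
    Z.IsGE 1 ∧ Z.IsLE 1 := by
  rw [isGE_iff, isLE_iff]
  refine ⟨fun n hn ↦ ?_, fun n hn ↦ ?_⟩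
  · refine (HomologySequence.exact₃ _ hT n (n + 1) rfl).isZero_X₂ ?_ ?_
    · dsimp
      by_cases h : n = 0
      · subst h
        exact (HomologySequence.epi_homologyMap_mor₁_iff _ hT 0).1
          (inferInstanceAs (Epi ((homologyFunctor C 0).map f)))
      · exact (isZero_of_isGE Y 0 n (by lia)).eq_of_src _ _
    · dsimp
      by_cases h : n = -1
      · subst h
        exact (HomologySequence.mono_homologyMap_mor₁_iff _ hT (-1) 0 rfl).1
          (inferInstanceAs (Mono ((homologyFunctor C 0).map f)))
      · by_cases h' : n = 0
        · subst h'
          exact (isZero_of_isLE X 0 _ (by lia)).eq_of_tgt _ _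
        · exact (isZero_of_isGE X 0 _ (by lia)).eq_of_tgt _ _
  · exact (HomologySequence.exact₃ _ hT n (n + 1) rfl).isZero_X₂
      ((isZero_of_isLE Y 1 n hn).eq_of_src _ _)
      ((isZero_of_isLE X 0 _ (by lia)).eq_of_tgt _ _)

lemma eq_zero_of_comp_eq_zero_of_isGE_cone {X Y Z : DerivedCategory C} {f : X ⟶ Y}
    {g : Y ⟶ Z} {h : Z ⟶ X⟦(1 : ℤ)⟧} (hT : Triangle.mk f g h ∈ distTriang _) (n : ℤ)
    [Z.IsGE n] {W : DerivedCategory C} [W.IsLE n] (a : W ⟶ X) (ha : a ≫ f = 0) : a = 0 := by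
  have : TStructure.t.IsLE (W⟦(1 : ℤ)⟧) (n - 1) := TStructure.t.isLE_shift W n 1 (n - 1) (by lia)
  obtain ⟨b, hb⟩ := Triangle.coyoneda_exact₁ _ hT (a⟦(1 : ℤ)⟧') (by
    change (shiftFunctor _ (1 : ℤ)).map a ≫ (shiftFunctor _ (1 : ℤ)).map f = 0
    rw [← Functor.map_comp, ha, Functor.map_zero])
  have hb₀ : b = 0 := TStructure.t.zero_of_isLE_of_isGE b (n - 1) n (by lia) this ‹_›
  apply (shiftFunctor _ (1 : ℤ)).map_injective
  rw [Functor.map_zero]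
  refine hb.trans ?_
  rw [hb₀]
  exact zero_comp

lemma exists_eq_comp_of_isGE_cone {X Y Z : DerivedCategory C} {f : X ⟶ Y}
    {g : Y ⟶ Z} {h : Z ⟶ X⟦(1 : ℤ)⟧} (hT : Triangle.mk f g h ∈ distTriang _) (n : ℤ)
    [Z.IsGE (n + 1)] {W : DerivedCategory C} [W.IsLE n] (a : W ⟶ Y) :
    ∃ b : W ⟶ X, a = b ≫ f :=
  Triangle.coyoneda_exact₂ _ hT a
    (TStructure.t.zero_of_isLE_of_isGE _ n (n + 1) (by lia) ‹_› ‹_›)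

/-- The homology of a cochain complex is the homology of its image in the derived category. -/
noncomputable def homologyIso (K : CochainComplex C ℤ) (n : ℤ) :
    (homologyFunctor C n).obj (Q.obj K) ≅ K.homology n :=
  (homologyFunctorFactors C n).app K

lemma homologyFunctor_map_Q_map {K L : CochainComplex C ℤ} (f : K ⟶ L) (n : ℤ) :
    (homologyFunctor C n).map (Q.map f) = (homologyIso K n).hom ≫
      HomologicalComplex.homologyMap f n ≫ (homologyIso L n).inv := by
  rw [← Category.assoc, Iso.eq_comp_inv]
  exact homologyFunctorFactors_hom_naturality f n

end DerivedCategory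

namespace CochainComplex
open HomologicalComplex
variable {C : Type*} [Category* C] [Abelian C] (V : CochainComplex C ℤ)

/-- The inclusion of the kernel of `V.d 0 1`, placed in degree `0`. -/
noncomputable def fromSingleKernel : (single C (.up ℤ) 0).obj (kernel (V.d 0 1)) ⟶ V :=
  mkHomFromSingle (kernel.ι (V.d 0 1)) (by
    intro k hk
    obtain rfl : k = 1 := by simpa using hk.symm
    simp)

/-- The inclusion of the top term of a complex vanishing in degrees `> 1`. -/
noncomputable def fromSingleTop [V.IsStrictlyLE 1] : (single C (.up ℤ) 1).obj (V.X 1) ⟶ V :=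
  mkHomFromSingle (𝟙 (V.X 1)) (by
    intro k hk
    obtain rfl : 1 + 1 = k := hk
    exact (V.isZero_of_isStrictlyLE 1 _ (by lia)).eq_of_tgt _ _)

/-- The projection to the bottom term of a complex vanishing in negative degrees. -/
noncomputable def toSingleBottom [V.IsStrictlyGE 0] : V ⟶ (single C (.up ℤ) 0).obj (V.X 0) :=
  mkHomToSingle (𝟙 (V.X 0)) (by
    intro k hk
    have hk : k + 1 = 0 := hk
    exact (V.isZero_of_isStrictlyGE 0 k (by lia)).eq_of_src _ _)

/-- The short complex given by the stupid filtration of a complex concentrated in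
degrees `[0, 1]`. -/
noncomputable def stupidShortComplex [V.IsStrictlyGE 0] [V.IsStrictlyLE 1] :
    ShortComplex (CochainComplex C ℤ) where
  X₁ := (single C (.up ℤ) 1).obj (V.X 1)
  X₂ := V
  X₃ := (single C (.up ℤ) 0).obj (V.X 0)
  f := V.fromSingleTop
  g := V.toSingleBottom
  zero := by
    apply from_single_hom_ext
    exact (isZero_single_obj_X _ _ _ _ (by simp)).eq_of_tgt _ _

/-- The stupid filtration is degreewise split. -/
noncomputable def stupidSplitting [V.IsStrictlyGE 0] [V.IsStrictlyLE 1] (n : ℤ) :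
    (V.stupidShortComplex.map (eval C _ n)).Splitting :=
  if h₁ : n = 1 then
    ShortComplex.Splitting.ofIsIsoOfIsZero _
      (by
        subst h₁
        change IsIso (V.fromSingleTop.f 1)
        rw [fromSingleTop, mkHomFromSingle_f]
        infer_instance)
      (isZero_single_obj_X (.up ℤ) _ _ _ (by lia))
  else
    ShortComplex.Splitting.ofIsZeroOfIsIso _
      (isZero_single_obj_X (.up ℤ) _ _ _ h₁)
      (by
        change IsIso (V.toSingleBottom.f n)
        by_cases h₀ : n = 0
        · subst h₀
          rw [toSingleBottom, mkHomToSingle_f]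
          infer_instance
        · have hV : IsZero (V.X n) := by
            by_cases h : n < 0
            · exact V.isZero_of_isStrictlyGE 0 n h
            · exact V.isZero_of_isStrictlyLE 1 n (by lia)
          exact ⟨0, hV.eq_of_src _ _, (isZero_single_obj_X _ _ _ _ h₀).eq_of_src _ _⟩)

lemma quasiIsoAt_fromSingleKernel [V.IsStrictlyGE 0] : QuasiIsoAt V.fromSingleKernel 0 := by
  rw [quasiIsoAt_iff' _ (-1) 0 1 (by simp) (by simp), ShortComplex.quasiIso_iff_of_zeros]
  · have h : V.fromSingleKernel.f 0 = (singleObjXSelf _ _ _).hom ≫ kernel.ι (V.d 0 1) :=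
      mkHomFromSingle_f _ _
    refine ⟨?_, ?_⟩
    · have w : V.fromSingleKernel.f 0 ≫ V.d 0 1 = 0 := by simp [h]
      change (ShortComplex.mk (V.fromSingleKernel.f 0) (V.d 0 1) w).Exact
      refine ShortComplex.exact_of_iso
        (S₁ := .mk _ _ (kernel.condition (V.d 0 1))) (ShortComplex.isoMk
        (singleObjXSelf (.up ℤ) 0 (kernel (V.d 0 1))).symm (Iso.refl _) (Iso.refl _) ?_ ?_)
        (ShortComplex.exact_kernel (V.d 0 1))
      · simp [h]
      · simp
    · change Mono (V.fromSingleKernel.f 0)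
      rw [h]
      infer_instance
  · rfl
  · rfl
  · exact (V.isZero_of_isStrictlyGE 0 _ (by lia)).eq_of_src _ _

lemma bijective_comp_pOpcycles_iff {X : C} :
    Function.Bijective (fun f : X ⟶ V.X 1 ↦ f ≫ V.pOpcycles 1) ↔
      Function.Bijective (fun f : X ⟶ V.X 1 ↦ f ≫ cokernel.π (V.d 0 1)) := by
  let e : V.opcycles 1 ≅ cokernel (V.d 0 1) :=
    { hom := V.descOpcycles (cokernel.π _) 0 (by simp) (by simp)
      inv := cokernel.desc _ (V.pOpcycles 1) (by simp)
      hom_inv_id := by simp [← cancel_epi (V.pOpcycles 1)]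
      inv_hom_id := by simp [← cancel_epi (cokernel.π (V.d 0 1))] }
  have he : V.pOpcycles 1 ≫ e.hom = cokernel.π (V.d 0 1) := by simp [e]
  rw [← e.homToEquiv.bijective.of_comp_iff']
  simp [Function.comp_def, he]

lemma f_one_eq_zero_of_homologyMap_eq_zero [V.IsStrictlyLE 1] (f : V ⟶ V)
    (hV : Function.Injective (fun g : V.X 1 ⟶ V.X 1 ↦ g ≫ V.pOpcycles 1))
    (hf : homologyMap f 1 = 0) : f.f 1 = 0 := by
  have := V.isIso_homologyι 1 2 (by simp) ((V.isZero_of_isStrictlyLE 1 _ (by lia)).eq_of_tgt _ _)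
  have h : opcyclesMap f 1 = 0 := by
    rw [← cancel_epi (V.homologyι 1), ← homologyι_naturality, hf, zero_comp, comp_zero]
  apply hV
  simp only
  rw [← p_opcyclesMap, h, comp_zero, zero_comp]

lemma eq_toSingleBottom_comp_of_f_one_eq_zero [V.IsStrictlyGE 0] [V.IsStrictlyLE 1]
    (f : V ⟶ V) (hf : f.f 1 = 0) :
    f = V.toSingleBottom ≫ (single C (.up ℤ) 0).map
      (kernel.lift (V.d 0 1) (f.f 0) (by rw [f.comm, hf, comp_zero])) ≫ V.fromSingleKernel := by
  ext n
  by_cases h₀ : n = 0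
  · subst h₀
    simp [toSingleBottom, fromSingleKernel, mkHomToSingle_f, mkHomFromSingle_f,
      single_map_f_self]
  · by_cases h₁ : n = 1
    · subst h₁
      refine hf.trans (Eq.symm ?_)
      rw [comp_f, (isZero_single_obj_X (.up ℤ) 0 (V.X 0) 1 h₀).eq_zero_of_tgt
        (V.toSingleBottom.f 1), zero_comp]
    · have hV : IsZero (V.X n) := by
        by_cases h : n < 0
        · exact V.isZero_of_isStrictlyGE 0 n h
        · exact V.isZero_of_isStrictlyLE 1 n (by lia)
      exact hV.eq_of_src _ _

lemma exists_homologyMap_eq [V.IsStrictlyLE 1]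
    (hV : Function.Surjective (fun g : V.X 1 ⟶ V.X 1 ↦ g ≫ V.pOpcycles 1))
    (β : ((single C (.up ℤ) 1).obj (V.X 1)).homology 1 ⟶ V.homology 1) :
    ∃ x : V.X 1 ⟶ V.X 1,
      homologyMap ((single C (.up ℤ) 1).map x ≫ V.fromSingleTop) 1 = β := by
  obtain ⟨x, hx⟩ := hV ((singleObjHomologySelfIso (.up ℤ) 1 (V.X 1)).inv ≫ β ≫ V.homologyι 1)
  refine ⟨x, ?_⟩
  rw [← cancel_epi (singleObjHomologySelfIso (.up ℤ) 1 (V.X 1)).inv,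
    ← cancel_mono (V.homologyι 1), Category.assoc, Category.assoc, ← hx, homologyι_naturality,
    singleObjHomologySelfIso_inv_homologyι_assoc, singleObjOpcyclesSelfIso_hom,
    Category.assoc, p_opcyclesMap]
  simp [fromSingleTop, mkHomFromSingle_f, single_map_f_self]

lemma trianglehOfDegreewiseSplit_distinguished (S : ShortComplex (CochainComplex C ℤ))
    (σ : ∀ n, (S.map (eval C _ n)).Splitting) :
    trianglehOfDegreewiseSplit S σ ∈ Pretriangulated.distinguishedTriangles :=
  (HomotopyCategory.distinguished_iff_iso_trianglehOfDegreewiseSplit _).2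
    ⟨S, σ, ⟨Iso.refl _⟩⟩

end CochainComplex

namespace CategoryTheory.Functor
open Pretriangulated

/-- A criterion for a triangulated functor to be bijective on the endomorphisms of the middle
object of a distinguished triangle. -/
lemma map_bijective_obj₂_of_distinguished {C D : Type*} [Category* C] [Category* D]
    [Preadditive C] [Preadditive D] [HasZeroObject C] [HasZeroObject D]
    [HasShift C ℤ] [HasShift D ℤ] [∀ n : ℤ, (shiftFunctor C n).Additive]
    [∀ n : ℤ, (shiftFunctor D n).Additive] [Pretriangulated C] [Pretriangulated D]
    (F : C ⥤ D) [F.Additive] [F.CommShift ℤ] [F.IsTriangulated]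
    (T : Triangle C) (hT : T ∈ distTriang C) {B : C} (i : B ⟶ T.obj₂)
    (h₁₁ : Function.Surjective (F.map : (T.obj₁ ⟶ T.obj₁) → _))
    (h₃₃ : Function.Surjective (F.map : (T.obj₃ ⟶ T.obj₃) → _))
    (h₃₁ : Function.Injective (F.map : (T.obj₃ ⟶ T.obj₁⟦(1 : ℤ)⟧) → _))
    (h₃B : Function.Bijective (F.map : (T.obj₃ ⟶ B) → _))
    (h₁B : Function.Surjective (F.map : (T.obj₁⟦(1 : ℤ)⟧ ⟶ B) → _))
    (lift₁ : ∀ φ : F.obj T.obj₁ ⟶ F.obj T.obj₂, ∃ a, φ = a ≫ F.map T.mor₁)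
    (lift₃ : ∀ φ : F.obj T.obj₃ ⟶ F.obj T.obj₂, ∃ a, φ = a ≫ F.map i)
    (fac : ∀ f : T.obj₂ ⟶ T.obj₂, F.map f = 0 → ∃ b : T.obj₃ ⟶ B, f = T.mor₂ ≫ b ≫ i)
    (cancel : ∀ g : F.obj T.obj₂ ⟶ F.obj B, g ≫ F.map i = 0 → g = 0) :
    Function.Bijective (F.map : (T.obj₂ ⟶ T.obj₂) → _) := by
  have hT' : Triangle.mk (F.map T.mor₁) (F.map T.mor₂)
      (F.map T.mor₃ ≫ (F.commShiftIso (1 : ℤ)).hom.app T.obj₁) ∈ distTriang D :=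
    F.map_distinguished T hT
  constructor
  · suffices ∀ f : T.obj₂ ⟶ T.obj₂, F.map f = 0 → f = 0 from fun f g h ↦
      sub_eq_zero.1 (this _ (by rw [F.map_sub, sub_eq_zero.2 h]))
    intro f hf
    obtain ⟨b, rfl⟩ := fac f hf
    have hb₀ : F.map T.mor₂ ≫ F.map b = 0 := cancel _ (by simpa using hf)
    obtain ⟨ψ, hψ⟩ : ∃ ψ, F.map b =
        (F.map T.mor₃ ≫ (F.commShiftIso (1 : ℤ)).hom.app T.obj₁) ≫ ψ :=
      Triangle.yoneda_exact₃ _ hT' (F.map b) hb₀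
    obtain ⟨ψ', hψ'⟩ := h₁B ((F.commShiftIso (1 : ℤ)).hom.app T.obj₁ ≫ ψ)
    have hb : b = T.mor₃ ≫ ψ' := h₃B.1 (by simpa [hψ'] using hψ)
    rw [hb, Category.assoc, comp_distTriang_mor_zero₂₃_assoc _ hT, zero_comp]
  · intro φ
    obtain ⟨a, ha⟩ := lift₁ (F.map T.mor₁ ≫ φ)
    obtain ⟨c, -, hc⟩ := complete_distinguished_triangle_morphism _ _ hT' hT' a φ ha
    obtain ⟨a, rfl⟩ := h₁₁ a
    obtain ⟨c, rfl⟩ := h₃₃ c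
    replace hc : (F.map T.mor₃ ≫ (F.commShiftIso (1 : ℤ)).hom.app T.obj₁) ≫ (F.map a)⟦(1 : ℤ)⟧' =
      F.map c ≫ F.map T.mor₃ ≫ (F.commShiftIso (1 : ℤ)).hom.app T.obj₁ := hc
    have comm : T.mor₃ ≫ a⟦(1 : ℤ)⟧' = c ≫ T.mor₃ := h₃₁ (by
      rw [← cancel_mono ((F.commShiftIso (1 : ℤ)).hom.app T.obj₁)]
      simpa using hc)
    obtain ⟨f, hf, -⟩ := complete_distinguished_triangle_morphism₂ _ _ hT hT a c comm
    have hφ : F.map T.mor₁ ≫ (φ - F.map f) = 0 := by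
      rw [Preadditive.comp_sub, ha, ← F.map_comp, ← F.map_comp, hf, sub_self]
    obtain ⟨ψ, hψ⟩ : ∃ ψ, φ - F.map f = F.map T.mor₂ ≫ ψ :=
      Triangle.yoneda_exact₂ _ hT' (φ - F.map f) hφ
    obtain ⟨ψ, rfl⟩ := lift₃ ψ
    obtain ⟨ψ, rfl⟩ := h₃B.2 ψ
    refine ⟨f + T.mor₂ ≫ ψ ≫ i, ?_⟩
    rw [F.map_add, F.map_comp, F.map_comp]
    exact (sub_eq_iff_eq_add'.1 hψ).symm

end CategoryTheory.Functor

namespace DerivedCategory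
variable {C : Type*} [Category* C] [Abelian C] [HasDerivedCategory C]

lemma subsingleton_singleFunctor_one_hom [HasExt C] (X Y : C)
    [Subsingleton (Abelian.Ext X Y 1)] :
    Subsingleton ((singleFunctor C 1).obj X ⟶ (singleFunctor C 0).obj Y) := by
  have : Subsingleton (ShiftedHom ((singleFunctor C 0).obj X) ((singleFunctor C 0).obj Y)
      ((1 : ℕ) : ℤ)) := Abelian.Ext.homEquiv.symm.subsingleton
  let e : ((singleFunctor C 1).obj X)⟦(1 : ℤ)⟧ ≅ (singleFunctor C 0).obj X :=
    ((singleFunctors C).shiftIso 1 0 1 (by simp)).app X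
  refine ⟨fun f g ↦ (shiftFunctor _ (1 : ℤ)).map_injective ?_⟩
  rw [← cancel_epi e.inv]
  exact Subsingleton.elim (α := ShiftedHom ((singleFunctor C 0).obj X)
    ((singleFunctor C 0).obj Y) ((1 : ℕ) : ℤ)) _ _

end DerivedCategory

lemma CochainComplex.exists_quotient_map_eq_of_Qh_map_eq_zero
    {C : Type*} [Category* C] [Abelian C] [HasDerivedCategory C] (V : CochainComplex C ℤ)
    [V.IsStrictlyGE 0] [V.IsStrictlyLE 1]
    (hV : Function.Injective (fun g : V.X 1 ⟶ V.X 1 ↦ g ≫ V.pOpcycles 1))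
    (f : (HomotopyCategory.quotient C (.up ℤ)).obj V ⟶
      (HomotopyCategory.quotient C (.up ℤ)).obj V) (hf : DerivedCategory.Qh.map f = 0) :
    ∃ b : (HomologicalComplex.single C (.up ℤ) 0).obj (V.X 0) ⟶
        (HomologicalComplex.single C (.up ℤ) 0).obj (kernel (V.d 0 1)),
      f = (HomotopyCategory.quotient C (.up ℤ)).map (V.toSingleBottom ≫ b ≫
        V.fromSingleKernel) := by
  obtain ⟨f, rfl⟩ := (HomotopyCategory.quotient C (.up ℤ)).map_surjective f
  replace hf : DerivedCategory.Q.map f = 0 := hf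
  have hf' : HomologicalComplex.homologyMap f 1 = 0 := by
    rw [← cancel_epi (DerivedCategory.homologyIso V 1).hom,
      ← cancel_mono (DerivedCategory.homologyIso V 1).inv, Category.assoc,
      ← DerivedCategory.homologyFunctor_map_Q_map, hf, Functor.map_zero, comp_zero, zero_comp]
  have hf₁ := V.f_one_eq_zero_of_homologyMap_eq_zero f hV hf'
  exact ⟨_, congrArg _ (V.eq_toSingleBottom_comp_of_f_one_eq_zero f hf₁)⟩

/-- Let `A` be an abelian category with enough projectives, and `V` a cochain complex
concentrated in degrees 0 and 1, with `A₀ = ker (V.d 0 1)` and `A₁ = coker (V.d 0 1)`.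
If `Hom(V¹, V¹) → Hom(V¹, A₁)` (postcomposition with the projection) is bijective and
`Ext¹(V¹, A₀) = 0`, then the canonical map
`Hom_{K(A)}(V, V) → Hom_{D(A)}(V, V)` is bijective. -/
theorem homotopyCategory_to_derivedCategory_bijective
    {A : Type u} [Category.{v} A] [Abelian A] [EnoughProjectives A]
    [HasDerivedCategory.{w} A] [HasExt.{w'} A]
    (V : CochainComplex A ℤ)
    (hV : ∀ i : ℤ, i ≠ 0 → i ≠ 1 → IsZero (V.X i))
    (hHom : Function.Bijective
      (fun g : V.X 1 ⟶ V.X 1 => g ≫ cokernel.π (V.d 0 1)))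
    (hExt : Subsingleton (Abelian.Ext (V.X 1) (kernel (V.d 0 1)) 1)) :
    Function.Bijective
      (fun g : (HomotopyCategory.quotient A (ComplexShape.up ℤ)).obj V ⟶
          (HomotopyCategory.quotient A (ComplexShape.up ℤ)).obj V =>
        DerivedCategory.Qh.map g) := by
  have : V.IsStrictlyGE 0 := (V.isStrictlyGE_iff 0).2 fun i hi ↦ hV i (by lia) (by lia)
  have : V.IsStrictlyLE 1 := (V.isStrictlyLE_iff 1).2 fun i hi ↦ hV i (by lia) (by lia)
  have hHom' := V.bijective_comp_pOpcycles_iff.2 hHom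
  let κ := HomotopyCategory.quotient A (ComplexShape.up ℤ)
  let B := (HomologicalComplex.single A (.up ℤ) 0).obj (kernel (V.d 0 1))
  let P := (HomologicalComplex.single A (.up ℤ) 1).obj (V.X 1)
  let ι : DerivedCategory.Q.obj B ⟶ DerivedCategory.Q.obj V :=
    DerivedCategory.Q.map V.fromSingleKernel
  have : (DerivedCategory.Q.obj B).IsGE 0 :=
    inferInstanceAs (((DerivedCategory.singleFunctor A 0).obj (kernel (V.d 0 1))).IsGE 0)
  have : (DerivedCategory.Q.obj B).IsLE 0 :=
    inferInstanceAs (((DerivedCategory.singleFunctor A 0).obj (kernel (V.d 0 1))).IsLE 0)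
  have : (DerivedCategory.Q.obj P).IsGE 1 :=
    inferInstanceAs (((DerivedCategory.singleFunctor A 1).obj (V.X 1)).IsGE 1)
  have : (DerivedCategory.Q.obj P).IsLE 1 :=
    inferInstanceAs (((DerivedCategory.singleFunctor A 1).obj (V.X 1)).IsLE 1)
  have : (DerivedCategory.Q.obj ((HomologicalComplex.single A (.up ℤ) 0).obj (V.X 0))).IsLE 0 :=
    inferInstanceAs (((DerivedCategory.singleFunctor A 0).obj (V.X 0)).IsLE 0)
  have : Subsingleton (DerivedCategory.Q.obj P ⟶ DerivedCategory.Q.obj B) :=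
    DerivedCategory.subsingleton_singleFunctor_one_hom (V.X 1) (kernel (V.d 0 1))
  have : IsIso ((DerivedCategory.homologyFunctor A 0).map ι) := by
    have := V.quasiIsoAt_fromSingleKernel
    rw [DerivedCategory.homologyFunctor_map_Q_map]
    have : IsIso (HomologicalComplex.homologyMap V.fromSingleKernel 0) := inferInstance
    infer_instance
  obtain ⟨C, p, δ, hC⟩ := Pretriangulated.distinguished_cocone_triangle ι
  obtain ⟨_, _⟩ := DerivedCategory.isGE_isLE_cone_of_isIso_homology_zero hC
  have : C.IsGE (0 + 1) := by simpa
  refine CategoryTheory.Functor.map_bijective_obj₂_of_distinguished DerivedCategory.Qh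
    _ (CochainComplex.trianglehOfDegreewiseSplit_distinguished V.stupidShortComplex
      V.stupidSplitting) (κ.map V.fromSingleKernel)
    (DerivedCategory.Qh_map_bijective_of_iso_singleFunctor_obj 1 (X := V.X 1) (Y := V.X 1)
      (Iso.refl _) (Iso.refl _)).2
    (DerivedCategory.Qh_map_bijective_of_iso_singleFunctor_obj 0 (X := V.X 0) (Y := V.X 0)
      (Iso.refl _) (Iso.refl _)).2
    (DerivedCategory.Qh_map_bijective_of_iso_singleFunctor_obj 0 (X := V.X 0) (Y := V.X 1)
      (Iso.refl _) (((HomotopyCategory.singleFunctors A).shiftIso 1 0 1 (by simp)).app _)).1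
    (DerivedCategory.Qh_map_bijective_of_iso_singleFunctor_obj 0 (X := V.X 0)
      (Y := kernel (V.d 0 1)) (Iso.refl _) (Iso.refl _))
    (DerivedCategory.Qh_map_bijective_of_iso_singleFunctor_obj 0 (X := V.X 1)
      (Y := kernel (V.d 0 1))
      (((HomotopyCategory.singleFunctors A).shiftIso 1 0 1 (by simp)).app _) (Iso.refl _)).2
    (fun (φ : DerivedCategory.Q.obj P ⟶ DerivedCategory.Q.obj V) ↦ ?_)
    (DerivedCategory.exists_eq_comp_of_isGE_cone hC 0
      (W := DerivedCategory.Q.obj ((HomologicalComplex.single A (.up ℤ) 0).obj (V.X 0))))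
    (fun f hf ↦ ?_)
    (DerivedCategory.eq_zero_of_comp_eq_zero_of_isGE_cone hC 1 (W := DerivedCategory.Q.obj V))
  · obtain ⟨x, hx⟩ := V.exists_homologyMap_eq hHom'.2
      ((DerivedCategory.homologyIso P 1).inv ≫ (DerivedCategory.homologyFunctor A 1).map φ ≫
        (DerivedCategory.homologyIso V 1).hom)
    let a : P ⟶ P := (HomologicalComplex.single A (.up ℤ) 1).map x
    refine ⟨DerivedCategory.Q.map a, ?_⟩
    change φ = DerivedCategory.Q.map a ≫ DerivedCategory.Q.map V.fromSingleTop
    rw [← Functor.map_comp]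
    have hφ : (DerivedCategory.homologyFunctor A 1).map
        (φ - DerivedCategory.Q.map (a ≫ V.fromSingleTop)) = 0 := by
      rw [Functor.map_sub, DerivedCategory.homologyFunctor_map_Q_map, hx]
      simp only [Category.assoc, Iso.hom_inv_id, Iso.hom_inv_id_assoc, Category.comp_id, sub_self]
    have hφp : (φ - DerivedCategory.Q.map (a ≫ V.fromSingleTop)) ≫ p = 0 :=
      DerivedCategory.hom_eq_zero_of_homologyFunctor_map_eq_zero 1 _ (by
        rw [Functor.map_comp, hφ, zero_comp])
    obtain ⟨b, hb⟩ : ∃ b, φ - DerivedCategory.Q.map (a ≫ V.fromSingleTop) = b ≫ ι :=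
      Pretriangulated.Triangle.coyoneda_exact₂ _ hC _ hφp
    rw [← sub_eq_zero, hb, Subsingleton.elim b 0, zero_comp]
  · obtain ⟨b, hb⟩ := V.exists_quotient_map_eq_of_Qh_map_eq_zero hHom'.1 f hf
    exact ⟨κ.map b, by rw [hb, κ.map_comp, κ.map_comp]; rfl⟩
end

section
/- Let 𝒜 be an abelian category and let A₀, A₁ be objects of 𝒜, regarded as objects of the derived category D(𝒜) concentrated in degree 0. For k = 1, 2, let A₀ →^{i_k} V_k →^{p_k} A₁⟦-1⟧ →^{δ_k} A₀⟦1⟧ be distinguished triangles in D(𝒜). Then the map Θ : Hom_{D(𝒜)}(A₁⟦-1⟧, A₀) → Hom_{D(𝒜)}(V₁, V₂) defined by Θ(ψ) = i₂ ∘ ψ ∘ p₁ is injective, and its image is exactly the set of morphisms φ : V₁ → V₂ with φ ∘ i₁ = 0 and p₂ ∘ φ = 0. (This expresses the exactness of the sequence 0 → Hom_{D}(A₁⟦-1⟧, A₀) → Hom_{D}(V₁, V₂) → Hom(A₀, A₀) ⊕ Hom_{D}(A₁⟦-1⟧, A₁⟦-1⟧).) -/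
open CategoryTheory CategoryTheory.Limits CategoryTheory.Pretriangulated

/-- If `Hom(X⟦1⟧, X)`, `Hom(X⟦1⟧, Y)` and `Hom(Y, Y⟦-1⟧)` vanish, then for distinguished triangles
`X → V_k → Y → X⟦1⟧`, the map `ψ ↦ p₁ ≫ ψ ≫ i₂` is injective. -/
lemma CategoryTheory.Pretriangulated.comp_comp_injective_of_distTriang
    {C : Type*} [Category* C] [HasZeroObject C] [HasShift C ℤ] [Preadditive C]
    [∀ n : ℤ, (shiftFunctor C n).Additive] [Pretriangulated C]
    {X Y V₁ V₂ : C} {i₁ : X ⟶ V₁} {p₁ : V₁ ⟶ Y} {δ₁ : Y ⟶ X⟦(1 : ℤ)⟧}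
    (h₁ : Triangle.mk i₁ p₁ δ₁ ∈ distTriang C)
    {i₂ : X ⟶ V₂} {p₂ : V₂ ⟶ Y} {δ₂ : Y ⟶ X⟦(1 : ℤ)⟧}
    (h₂ : Triangle.mk i₂ p₂ δ₂ ∈ distTriang C)
    (hXX : ∀ f : X⟦(1 : ℤ)⟧ ⟶ X, f = 0) (hXY : ∀ f : X⟦(1 : ℤ)⟧ ⟶ Y, f = 0)
    (hYY : ∀ f : Y ⟶ Y⟦(-1 : ℤ)⟧, f = 0) :
    Function.Injective (fun ψ : Y ⟶ X => p₁ ≫ ψ ≫ i₂) := by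
  intro ψ ψ' h
  rw [← sub_eq_zero]
  have hp : p₁ ≫ (ψ - ψ') ≫ i₂ = 0 := by
    simpa [sub_eq_zero] using h
  obtain ⟨g, hg⟩ : ∃ g : X⟦(1 : ℤ)⟧ ⟶ V₂, (ψ - ψ') ≫ i₂ = δ₁ ≫ g :=
    Triangle.yoneda_exact₃ _ h₁ _ hp
  obtain ⟨k, hk⟩ : ∃ k : X⟦(1 : ℤ)⟧ ⟶ X, g = k ≫ i₂ :=
    Triangle.coyoneda_exact₂ _ h₂ g (hXY _)
  have hi : (ψ - ψ') ≫ i₂ = 0 := by rw [hg, hk, hXX k, zero_comp, comp_zero]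
  obtain ⟨l, hl⟩ := Triangle.coyoneda_exact₂ _ (inv_rot_of_distTriang _ h₂) (ψ - ψ') hi
  rw [hl, hYY l]
  exact zero_comp

/-- If `Hom(X⟦1⟧, Y)` vanishes, then for distinguished triangles `X → V_k → Y → X⟦1⟧`, the
morphisms of the form `p₁ ≫ ψ ≫ i₂` are those killed by `i₁` on the left and `p₂` on the right. -/
lemma CategoryTheory.Pretriangulated.exists_comp_comp_eq_iff_of_distTriang
    {C : Type*} [Category* C] [HasZeroObject C] [HasShift C ℤ] [Preadditive C]
    [∀ n : ℤ, (shiftFunctor C n).Additive] [Pretriangulated C]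
    {X Y V₁ V₂ : C} {i₁ : X ⟶ V₁} {p₁ : V₁ ⟶ Y} {δ₁ : Y ⟶ X⟦(1 : ℤ)⟧}
    (h₁ : Triangle.mk i₁ p₁ δ₁ ∈ distTriang C)
    {i₂ : X ⟶ V₂} {p₂ : V₂ ⟶ Y} {δ₂ : Y ⟶ X⟦(1 : ℤ)⟧}
    (h₂ : Triangle.mk i₂ p₂ δ₂ ∈ distTriang C)
    (hXY : ∀ f : X⟦(1 : ℤ)⟧ ⟶ Y, f = 0) (φ : V₁ ⟶ V₂) :
    (∃ ψ : Y ⟶ X, p₁ ≫ ψ ≫ i₂ = φ) ↔ (i₁ ≫ φ = 0 ∧ φ ≫ p₂ = 0) := by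
  constructor
  · rintro ⟨ψ, rfl⟩
    have w₁ : i₁ ≫ p₁ = 0 := comp_distTriang_mor_zero₁₂ _ h₁
    have w₂ : i₂ ≫ p₂ = 0 := comp_distTriang_mor_zero₁₂ _ h₂
    exact ⟨by rw [reassoc_of% w₁, zero_comp], by simp [w₂]⟩
  · rintro ⟨hi, hp⟩
    obtain ⟨g, rfl⟩ : ∃ g : Y ⟶ V₂, φ = p₁ ≫ g := Triangle.yoneda_exact₂ _ h₁ φ hi
    obtain ⟨k, hk⟩ : ∃ k : X⟦(1 : ℤ)⟧ ⟶ Y, g ≫ p₂ = δ₁ ≫ k :=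
      Triangle.yoneda_exact₃ _ h₁ (g ≫ p₂) ((Category.assoc _ _ _).symm.trans hp)
    have hg : g ≫ p₂ = 0 := by rw [hk, hXY k, comp_zero]
    obtain ⟨ψ, rfl⟩ : ∃ ψ : Y ⟶ X, g = ψ ≫ i₂ := Triangle.coyoneda_exact₂ _ h₂ g hg
    exact ⟨ψ, rfl⟩

/-- Given distinguished triangles `A₀ → V_k → A₁⟦-1⟧ → A₀⟦1⟧` (k = 1, 2) in the derived
category of an abelian category, the map `ψ ↦ i₂ ∘ ψ ∘ p₁` from
`Hom(A₁⟦-1⟧, A₀)` to `Hom(V₁, V₂)` is injective, and its image consists exactly of the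
morphisms `φ : V₁ ⟶ V₂` with `φ ∘ i₁ = 0` and `p₂ ∘ φ = 0`. -/
theorem hom_between_cones_exact
    {A : Type u} [Category.{v} A] [Abelian A] [HasDerivedCategory.{w} A]
    (A₀ A₁ : A) (V₁ V₂ : DerivedCategory A)
    (i₁ : (DerivedCategory.singleFunctor A 0).obj A₀ ⟶ V₁)
    (p₁ : V₁ ⟶ ((DerivedCategory.singleFunctor A 0).obj A₁)⟦(-1 : ℤ)⟧)
    (δ₁ : ((DerivedCategory.singleFunctor A 0).obj A₁)⟦(-1 : ℤ)⟧ ⟶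
      ((DerivedCategory.singleFunctor A 0).obj A₀)⟦(1 : ℤ)⟧)
    (h₁ : Triangle.mk i₁ p₁ δ₁ ∈ distTriang (DerivedCategory A))
    (i₂ : (DerivedCategory.singleFunctor A 0).obj A₀ ⟶ V₂)
    (p₂ : V₂ ⟶ ((DerivedCategory.singleFunctor A 0).obj A₁)⟦(-1 : ℤ)⟧)
    (δ₂ : ((DerivedCategory.singleFunctor A 0).obj A₁)⟦(-1 : ℤ)⟧ ⟶
      ((DerivedCategory.singleFunctor A 0).obj A₀)⟦(1 : ℤ)⟧)
    (h₂ : Triangle.mk i₂ p₂ δ₂ ∈ distTriang (DerivedCategory A)) :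
    Function.Injective
      (fun ψ : ((DerivedCategory.singleFunctor A 0).obj A₁)⟦(-1 : ℤ)⟧ ⟶
          (DerivedCategory.singleFunctor A 0).obj A₀ => p₁ ≫ ψ ≫ i₂) ∧
    ∀ φ : V₁ ⟶ V₂,
      (∃ ψ : ((DerivedCategory.singleFunctor A 0).obj A₁)⟦(-1 : ℤ)⟧ ⟶
          (DerivedCategory.singleFunctor A 0).obj A₀, p₁ ≫ ψ ≫ i₂ = φ) ↔
      (i₁ ≫ φ = 0 ∧ φ ≫ p₂ = 0) := by
  let t := DerivedCategory.TStructure.t (C := A)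
  set X := (DerivedCategory.singleFunctor A 0).obj A₀
  set S := (DerivedCategory.singleFunctor A 0).obj A₁
  have : t.IsGE X 0 := inferInstanceAs (X.IsGE 0)
  have : t.IsLE X 0 := inferInstanceAs (X.IsLE 0)
  have : t.IsGE S 0 := inferInstanceAs (S.IsGE 0)
  have : t.IsLE S 0 := inferInstanceAs (S.IsLE 0)
  have : t.IsLE (X⟦(1 : ℤ)⟧) (-1) := t.isLE_shift X 0 1 (-1)
  have : t.IsGE (S⟦(-1 : ℤ)⟧) 1 := t.isGE_shift S 0 (-1) 1
  have : t.IsLE (S⟦(-1 : ℤ)⟧) 1 := t.isLE_shift S 0 (-1) 1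
  have : t.IsGE (S⟦(-1 : ℤ)⟧⟦(-1 : ℤ)⟧) 2 := t.isGE_shift _ 1 (-1) 2
  have hXY (f : X⟦(1 : ℤ)⟧ ⟶ S⟦(-1 : ℤ)⟧) : f = 0 := t.zero f (-1) 1
  exact ⟨comp_comp_injective_of_distTriang h₁ h₂ (fun f => t.zero f (-1) 0) hXY
    (fun f => t.zero f 1 2), exists_comp_comp_eq_iff_of_distTriang h₁ h₂ hXY⟩
end

section
/- Let 𝒜 be an abelian category and let A₀, A₁ be objects of 𝒜, regarded as objects of the derived category D(𝒜) concentrated in degree 0. Let A₀ →^{i} V →^{p} A₁⟦-1⟧ →^{δ} A₀⟦1⟧ be a distinguished triangle in D(𝒜). Then the map sending f ∈ Hom_𝒜(A₁, A₀) to i⟦-1⟧ ∘ f⟦-1⟧ ∘ p is an additive bijection from Hom_𝒜(A₁, A₀) onto Hom_{D(𝒜)}(V, V⟦-1⟧). -/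
open CategoryTheory CategoryTheory.Limits CategoryTheory.Pretriangulated

/-- If `T` and `T'` are distinguished triangles such that the relevant Hom groups vanish, then every
morphism `T.obj₂ ⟶ T'.obj₂` factors uniquely through a morphism `T.obj₃ ⟶ T'.obj₁`. -/
theorem CategoryTheory.Pretriangulated.bijective_mor₂_comp_comp_mor₁
    {C : Type*} [Category* C] [Preadditive C] [HasZeroObject C] [HasShift C ℤ]
    [∀ n : ℤ, (shiftFunctor C n).Additive] [Pretriangulated C]
    {T T' : Triangle C} (hT : T ∈ distTriang C) (hT' : T' ∈ distTriang C)
    (h₁₁ : ∀ f : T.obj₁ ⟶ T'.obj₁, f = 0)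
    (h₁₁' : ∀ f : T.obj₁⟦(1 : ℤ)⟧ ⟶ T'.obj₁, f = 0)
    (h₂₃ : ∀ f : T.obj₂ ⟶ T'.obj₃, f = 0)
    (h₂₃' : ∀ f : T.obj₂ ⟶ T'.obj₃⟦(-1 : ℤ)⟧, f = 0) :
    Function.Bijective (fun g : T.obj₃ ⟶ T'.obj₁ => T.mor₂ ≫ g ≫ T'.mor₁) := by
  constructor
  · intro g g' hg
    have hcomp : (T.mor₂ ≫ (g - g')) ≫ T'.mor₁ = 0 := by
      simpa [sub_eq_zero] using hg
    obtain ⟨x, hx⟩ := Triangle.coyoneda_exact₂ _ (inv_rot_of_distTriang _ hT') _ hcomp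
    obtain rfl : x = 0 := h₂₃' x
    obtain ⟨y, hy⟩ := Triangle.yoneda_exact₃ _ hT (g - g') (hx.trans zero_comp)
    rw [h₁₁' y, comp_zero] at hy
    exact sub_eq_zero.mp hy
  · intro φ
    obtain ⟨ψ, rfl⟩ := Triangle.coyoneda_exact₂ _ hT' φ (h₂₃ _)
    obtain ⟨g, rfl⟩ := Triangle.yoneda_exact₂ _ hT ψ (h₁₁ _)
    exact ⟨g, (Category.assoc _ _ _).symm⟩

/-- Given a distinguished triangle `A₀ →ⁱ V →ᵖ A₁⟦-1⟧ →^δ A₀⟦1⟧` in the derived category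
of an abelian category, the map `f ↦ i⟦-1⟧ ∘ f⟦-1⟧ ∘ p` is an additive bijection from
`Hom_A(A₁, A₀)` onto `Hom_{D(A)}(V, V⟦-1⟧)`. -/
theorem hom_V_V_shift_neg_one
    {A : Type u} [Category.{v} A] [Abelian A] [HasDerivedCategory.{w} A]
    (A₀ A₁ : A) (V : DerivedCategory A)
    (i : (DerivedCategory.singleFunctor A 0).obj A₀ ⟶ V)
    (p : V ⟶ ((DerivedCategory.singleFunctor A 0).obj A₁)⟦(-1 : ℤ)⟧)
    (δ : ((DerivedCategory.singleFunctor A 0).obj A₁)⟦(-1 : ℤ)⟧ ⟶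
      ((DerivedCategory.singleFunctor A 0).obj A₀)⟦(1 : ℤ)⟧)
    (h : Triangle.mk i p δ ∈ distTriang (DerivedCategory A)) :
    Function.Bijective
      (fun f : A₁ ⟶ A₀ =>
        p ≫ ((DerivedCategory.singleFunctor A 0).map f)⟦(-1 : ℤ)⟧' ≫ i⟦(-1 : ℤ)⟧') ∧
    ∀ f g : A₁ ⟶ A₀,
      (p ≫ ((DerivedCategory.singleFunctor A 0).map (f + g))⟦(-1 : ℤ)⟧' ≫ i⟦(-1 : ℤ)⟧') =
      (p ≫ ((DerivedCategory.singleFunctor A 0).map f)⟦(-1 : ℤ)⟧' ≫ i⟦(-1 : ℤ)⟧') +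
      (p ≫ ((DerivedCategory.singleFunctor A 0).map g)⟦(-1 : ℤ)⟧' ≫ i⟦(-1 : ℤ)⟧') := by
  refine ⟨?_, fun f g => by simp [Functor.map_add]⟩
  let t := DerivedCategory.TStructure.t (C := A)
  let S := DerivedCategory.singleFunctor A 0
  have hA₀ : t.IsLE (S.obj A₀) 0 := inferInstanceAs ((S.obj A₀).IsLE 0)
  have hA₀' : t.IsGE (S.obj A₀) 0 := inferInstanceAs ((S.obj A₀).IsGE 0)
  have hA₁ : t.IsLE (S.obj A₁) 0 := inferInstanceAs ((S.obj A₁).IsLE 0)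
  have hA₁' : t.IsGE (S.obj A₁) 0 := inferInstanceAs ((S.obj A₁).IsGE 0)
  have hA₀_neg : t.IsGE ((S.obj A₀)⟦(-1 : ℤ)⟧) 1 := t.isGE_shift _ 0 _ _
  have hA₀_one : t.IsLE ((S.obj A₀)⟦(1 : ℤ)⟧) (-1) := t.isLE_shift _ 0 _ _
  have hA₁_neg : t.IsLE ((S.obj A₁)⟦(-1 : ℤ)⟧) 1 := t.isLE_shift _ 0 _ _
  have hA₁_neg' : t.IsGE ((S.obj A₁)⟦(-1 : ℤ)⟧) 1 := t.isGE_shift _ 0 _ _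
  have hA₁_neg_neg : t.IsGE ((S.obj A₁)⟦(-1 : ℤ)⟧⟦(-1 : ℤ)⟧) 2 := t.isGE_shift _ 1 _ _
  have hA₁_neg_neg_neg : t.IsGE ((S.obj A₁)⟦(-1 : ℤ)⟧⟦(-1 : ℤ)⟧⟦(-1 : ℤ)⟧) 3 :=
    t.isGE_shift _ 2 _ _
  have hV : t.IsLE V 1 := t.isLE₂ _ h 1 (t.isLE_of_le (S.obj A₀) 0 1) hA₁_neg
  have hbij := bijective_mor₂_comp_comp_mor₁ h (Triangle.shift_distinguished _ h (-1))
    (fun f => t.zero_of_isLE_of_isGE f 0 1 (by lia) hA₀ hA₀_neg)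
    (fun f => t.zero_of_isLE_of_isGE f (-1) 1 (by lia) hA₀_one hA₀_neg)
    (fun f => t.zero_of_isLE_of_isGE f 1 2 (by lia) hV hA₁_neg_neg)
    (fun f => t.zero_of_isLE_of_isGE f 1 3 (by lia) hV hA₁_neg_neg_neg)
  have hfull : Function.Bijective (fun f : A₁ ⟶ A₀ => (S.map f)⟦(-1 : ℤ)⟧') :=
    ⟨(S ⋙ shiftFunctor _ (-1 : ℤ)).map_injective, (S ⋙ shiftFunctor _ (-1 : ℤ)).map_surjective⟩
  convert (Equiv.neg (V ⟶ V⟦(-1 : ℤ)⟧)).bijective.comp (hbij.comp hfull) using 1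
  funext f
  change _ = -(p ≫ (S.map f)⟦(-1 : ℤ)⟧' ≫ ((-1 : ℤ).negOnePow • i⟦(-1 : ℤ)⟧'))
  simp [S]
end

section
/- Let 𝒜 be an abelian category and let A₀, A₁ be objects of 𝒜, regarded as objects of the derived category D(𝒜) concentrated in degree 0. Let e, e' : A₁⟦-2⟧ → A₀ be morphisms in D(𝒜) (equivalently, classes in Ext²(A₁, A₀)), and let V and V' be objects fitting in distinguished triangles A₁⟦-2⟧ →^{e} A₀ →^{i} V →^{p} A₁⟦-1⟧ and A₁⟦-2⟧ →^{e'} A₀ →^{i'} V' →^{p'} A₁⟦-1⟧, i.e. V and V' are cones of e and e'. Then V and V' are isomorphic in D(𝒜) if and only if there exist isomorphisms g₀ : A₀ → A₀ and g₁ : A₁ → A₁ in 𝒜 such that g₀ ∘ e = e' ∘ g₁⟦-2⟧. -/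
open CategoryTheory CategoryTheory.Limits CategoryTheory.Pretriangulated

/-- Let `e, e' : A₁⟦-2⟧ ⟶ A₀` be morphisms in the derived category of an abelian
category (i.e. classes in `Ext²(A₁, A₀)`), and let `V`, `V'` be cones of `e`, `e'`.
Then `V ≅ V'` if and only if there are automorphisms `g₀` of `A₀` and `g₁` of `A₁`
with `g₀ ∘ e = e' ∘ g₁⟦-2⟧`. -/
theorem cones_iso_iff_ext_classes_conjugate
    {A : Type u} [Category.{v} A] [Abelian A] [HasDerivedCategory.{w} A]
    (A₀ A₁ : A)
    (e e' : ((DerivedCategory.singleFunctor A 0).obj A₁)⟦(-2 : ℤ)⟧ ⟶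
      (DerivedCategory.singleFunctor A 0).obj A₀)
    (V V' : DerivedCategory A)
    (i : (DerivedCategory.singleFunctor A 0).obj A₀ ⟶ V)
    (p : V ⟶ (((DerivedCategory.singleFunctor A 0).obj A₁)⟦(-2 : ℤ)⟧)⟦(1 : ℤ)⟧)
    (h : Triangle.mk e i p ∈ distTriang (DerivedCategory A))
    (i' : (DerivedCategory.singleFunctor A 0).obj A₀ ⟶ V')
    (p' : V' ⟶ (((DerivedCategory.singleFunctor A 0).obj A₁)⟦(-2 : ℤ)⟧)⟦(1 : ℤ)⟧)
    (h' : Triangle.mk e' i' p' ∈ distTriang (DerivedCategory A)) :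
    Nonempty (V ≅ V') ↔
      ∃ (g₀ : A₀ ≅ A₀) (g₁ : A₁ ≅ A₁),
        e ≫ (DerivedCategory.singleFunctor A 0).map g₀.hom =
          ((DerivedCategory.singleFunctor A 0).map g₁.hom)⟦(-2 : ℤ)⟧' ≫ e' := by
  constructor
  · rintro ⟨f⟩
    have hA₁ : (((DerivedCategory.singleFunctor A 0).obj A₁)⟦(-2 : ℤ)⟧⟦(1 : ℤ)⟧).IsGE 1 := by
      have : (((DerivedCategory.singleFunctor A 0).obj A₁)⟦(-2 : ℤ)⟧).IsGE 2 :=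
        DerivedCategory.TStructure.t.isGE_shift _ 0 (-2) 2
      exact DerivedCategory.TStructure.t.isGE_shift _ 2 1 1
    have hA₀ : ((DerivedCategory.singleFunctor A 0).obj A₀).IsLE 0 := inferInstance
    obtain ⟨φ, -⟩ := DerivedCategory.TStructure.t.triangle_iso_exists
      (rot_of_distTriang _ h) (rot_of_distTriang _ h') f 0 1 hA₀ hA₁ hA₀ hA₁
    let ψ : Triangle.mk e i p ≅ Triangle.mk e' i' p' :=
      (rotate (DerivedCategory A)).preimageIso φ
    let α : ((DerivedCategory.singleFunctor A 0).obj A₁)⟦(-2 : ℤ)⟧ ≅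
        ((DerivedCategory.singleFunctor A 0).obj A₁)⟦(-2 : ℤ)⟧ := Triangle.π₁.mapIso ψ
    let β : (DerivedCategory.singleFunctor A 0).obj A₀ ≅
        (DerivedCategory.singleFunctor A 0).obj A₀ := Triangle.π₂.mapIso ψ
    refine ⟨(DerivedCategory.singleFunctor A 0).preimageIso β,
      (DerivedCategory.singleFunctor A 0).preimageIso
        ((shiftFunctor (DerivedCategory A) (-2 : ℤ)).preimageIso α), ?_⟩
    simp only [Functor.preimageIso_hom, Functor.map_preimage]
    exact ψ.hom.comm₁
  · rintro ⟨g₀, g₁, comm⟩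
    exact ⟨Triangle.π₃.mapIso (isoTriangleOfIso₁₂ _ _ h h'
      ((shiftFunctor (DerivedCategory A) (-2 : ℤ)).mapIso
        ((DerivedCategory.singleFunctor A 0).mapIso g₁))
      ((DerivedCategory.singleFunctor A 0).mapIso g₀) comm)⟩
end

section
/- Let 𝒜 be an abelian category and let A₀, A₁ be objects of 𝒜, regarded as objects of the derived category D(𝒜) concentrated in degree 0. Let e : A₁⟦-2⟧ → A₀ be a morphism in D(𝒜) and let A₁⟦-2⟧ →^{e} A₀ →^{i} V →^{p} A₁⟦-1⟧ be a distinguished triangle. Then: (i) for every isomorphism φ : V → V in D(𝒜) there exist unique morphisms g₀ : A₀ → A₀ and g₁ : A₁ → A₁ in 𝒜 with φ ∘ i = i ∘ g₀ and p ∘ φ = g₁⟦-1⟧ ∘ p, and these g₀, g₁ are isomorphisms satisfying g₀ ∘ e = e ∘ g₁⟦-2⟧; (ii) conversely, for any isomorphisms g₀ : A₀ → A₀ and g₁ : A₁ → A₁ with g₀ ∘ e = e ∘ g₁⟦-2⟧, there exists an isomorphism φ : V → V in D(𝒜) with φ ∘ i = i ∘ g₀ and p ∘ φ = g₁⟦-1⟧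 ∘ p. -/
open CategoryTheory CategoryTheory.Limits CategoryTheory.Pretriangulated

section EndomorphismsOfCone

variable {C : Type*} [Category C] [Preadditive C] [HasZeroObject C] [HasShift C ℤ]
  [∀ n : ℤ, (shiftFunctor C n).Additive] [Pretriangulated C]
  {X Y V : C} {e : X ⟶ Y} {i : Y ⟶ V} {p : V ⟶ X⟦(1 : ℤ)⟧}

lemma eq_of_comp_mor₂_eq (h : Triangle.mk e i p ∈ distTriang C)
    (hYX : ∀ f : Y ⟶ X, f = 0) {a b : Y ⟶ Y} (hab : a ≫ i = b ≫ i) : a = b := by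
  have hab' : (a - b) ≫ i = 0 := by rw [Preadditive.sub_comp, hab, sub_self]
  obtain ⟨k, hk⟩ : ∃ k : Y ⟶ X, a - b = k ≫ e := Triangle.coyoneda_exact₂ _ h (a - b) hab'
  rw [← sub_eq_zero, hk, hYX k, zero_comp]

lemma eq_of_mor₃_comp_shift_eq (h : Triangle.mk e i p ∈ distTriang C)
    (hYX : ∀ f : Y ⟶ X, f = 0) {a b : X ⟶ X}
    (hab : p ≫ a⟦(1 : ℤ)⟧' = p ≫ b⟦(1 : ℤ)⟧') : a = b := by
  apply (shiftFunctor C (1 : ℤ)).map_injective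
  have hab' : p ≫ (a⟦(1 : ℤ)⟧' - b⟦(1 : ℤ)⟧') = 0 := by
    rw [Preadditive.comp_sub, hab, sub_self]
  obtain ⟨k, hk⟩ : ∃ k : Y⟦(1 : ℤ)⟧ ⟶ X⟦(1 : ℤ)⟧,
      a⟦(1 : ℤ)⟧' - b⟦(1 : ℤ)⟧' = (-e⟦(1 : ℤ)⟧') ≫ k :=
    Triangle.yoneda_exact₂ _ (rot_of_distTriang _ (rot_of_distTriang _ h)) _ hab'
  obtain ⟨k', rfl⟩ := (shiftFunctor C (1 : ℤ)).map_surjective k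
  rw [← sub_eq_zero, hk, hYX k', Functor.map_zero, comp_zero]

/-- Every endomorphism of the third vertex of a distinguished triangle `X ⟶ Y ⟶ V ⟶ X⟦1⟧`
extends to a morphism of triangles if there are no nonzero maps `Y ⟶ X⟦1⟧`. -/
lemma exists_triangle_endomorphism_of_hom₃ (h : Triangle.mk e i p ∈ distTriang C)
    (hYX₁ : ∀ f : Y ⟶ X⟦(1 : ℤ)⟧, f = 0) (φ : V ⟶ V) :
    ∃ (b : Y ⟶ Y) (a : X ⟶ X),
      i ≫ φ = b ≫ i ∧ φ ≫ p = p ≫ a⟦(1 : ℤ)⟧' ∧ e ≫ b = a ≫ e := by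
  obtain ⟨b, hb⟩ := Triangle.coyoneda_exact₃ _ h (i ≫ φ) (hYX₁ _)
  obtain ⟨a, ha, ha'⟩ := complete_distinguished_triangle_morphism₁ _ _ h h b φ hb
  exact ⟨b, a, hb, ha'.symm, ha⟩

end EndomorphismsOfCone

namespace DerivedCategory

variable {A : Type*} [Category A] [Abelian A] [HasDerivedCategory A]

lemma singleFunctor_hom_shift_eq_zero {A₀ A₁ : A} {n : ℤ} (hn : n < 0)
    (f : (singleFunctor A 0).obj A₀ ⟶ ((singleFunctor A 0).obj A₁)⟦n⟧) : f = 0 := by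
  have : TStructure.t.IsLE ((singleFunctor A 0).obj A₀) 0 :=
    inferInstanceAs (((singleFunctor A 0).obj A₀).IsLE 0)
  have : TStructure.t.IsGE ((singleFunctor A 0).obj A₁) 0 :=
    inferInstanceAs (((singleFunctor A 0).obj A₁).IsGE 0)
  have : TStructure.t.IsGE (((singleFunctor A 0).obj A₁)⟦n⟧) (-n) :=
    TStructure.t.isGE_shift _ 0 n (-n)
  exact TStructure.t.zero f 0 (-n)

end DerivedCategory

/-- Let `e : A₁⟦-2⟧ ⟶ A₀` be a morphism in the derived category of an abelian category
and `A₁⟦-2⟧ →^e A₀ →^i V →^p A₁⟦-1⟧` a distinguished triangle. Then: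
(i) every automorphism `φ` of `V` induces unique morphisms `g₀ : A₀ ⟶ A₀`,
`g₁ : A₁ ⟶ A₁` with `φ ∘ i = i ∘ g₀` and `p ∘ φ = g₁⟦-1⟧ ∘ p`, and any such `g₀, g₁`
are isomorphisms satisfying `g₀ ∘ e = e ∘ g₁⟦-2⟧`;
(ii) conversely, any isomorphisms `g₀, g₁` with `g₀ ∘ e = e ∘ g₁⟦-2⟧` arise this way
from some automorphism `φ` of `V`. -/
theorem automorphisms_of_cone
    {A : Type u} [Category.{v} A] [Abelian A] [HasDerivedCategory.{w} A]
    (A₀ A₁ : A)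
    (e : ((DerivedCategory.singleFunctor A 0).obj A₁)⟦(-2 : ℤ)⟧ ⟶
      (DerivedCategory.singleFunctor A 0).obj A₀)
    (V : DerivedCategory A)
    (i : (DerivedCategory.singleFunctor A 0).obj A₀ ⟶ V)
    (p : V ⟶ (((DerivedCategory.singleFunctor A 0).obj A₁)⟦(-2 : ℤ)⟧)⟦(1 : ℤ)⟧)
    (h : Triangle.mk e i p ∈ distTriang (DerivedCategory A)) :
    (∀ φ : V ≅ V,
      (∃! g : (A₀ ⟶ A₀) × (A₁ ⟶ A₁),
        i ≫ φ.hom = (DerivedCategory.singleFunctor A 0).map g.1 ≫ i ∧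
        φ.hom ≫ p =
          p ≫ (((DerivedCategory.singleFunctor A 0).map g.2)⟦(-2 : ℤ)⟧')⟦(1 : ℤ)⟧') ∧
      ∀ (g₀ : A₀ ⟶ A₀) (g₁ : A₁ ⟶ A₁),
        i ≫ φ.hom = (DerivedCategory.singleFunctor A 0).map g₀ ≫ i →
        φ.hom ≫ p =
          p ≫ (((DerivedCategory.singleFunctor A 0).map g₁)⟦(-2 : ℤ)⟧')⟦(1 : ℤ)⟧' →
        IsIso g₀ ∧ IsIso g₁ ∧
          e ≫ (DerivedCategory.singleFunctor A 0).map g₀ =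
            ((DerivedCategory.singleFunctor A 0).map g₁)⟦(-2 : ℤ)⟧' ≫ e) ∧
    (∀ (g₀ : A₀ ≅ A₀) (g₁ : A₁ ≅ A₁),
      e ≫ (DerivedCategory.singleFunctor A 0).map g₀.hom =
        ((DerivedCategory.singleFunctor A 0).map g₁.hom)⟦(-2 : ℤ)⟧' ≫ e →
      ∃ φ : V ≅ V,
        i ≫ φ.hom = (DerivedCategory.singleFunctor A 0).map g₀.hom ≫ i ∧
        φ.hom ≫ p =
          p ≫ (((DerivedCategory.singleFunctor A 0).map g₁.hom)⟦(-2 : ℤ)⟧')⟦(1 : ℤ)⟧') := by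
  have hYX :=
    DerivedCategory.singleFunctor_hom_shift_eq_zero (A₀ := A₀) (A₁ := A₁) (n := -2) (by norm_num)
  have hYX₁ (f : (DerivedCategory.singleFunctor A 0).obj A₀ ⟶
      (((DerivedCategory.singleFunctor A 0).obj A₁)⟦(-2 : ℤ)⟧)⟦(1 : ℤ)⟧) : f = 0 := by
    rw [← cancel_mono ((shiftFunctorAdd' (DerivedCategory A) (-2 : ℤ) 1 (-1)
      (by norm_num)).inv.app _), zero_comp]
    exact DerivedCategory.singleFunctor_hom_shift_eq_zero (by norm_num) _
  have unique₀ {a b : A₀ ⟶ A₀}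
      (hab : (DerivedCategory.singleFunctor A 0).map a ≫ i =
        (DerivedCategory.singleFunctor A 0).map b ≫ i) : a = b :=
    (DerivedCategory.singleFunctor A 0).map_injective (eq_of_comp_mor₂_eq h hYX hab)
  have unique₁ {a b : A₁ ⟶ A₁}
      (hab : p ≫ (((DerivedCategory.singleFunctor A 0).map a)⟦(-2 : ℤ)⟧')⟦(1 : ℤ)⟧' =
        p ≫ (((DerivedCategory.singleFunctor A 0).map b)⟦(-2 : ℤ)⟧')⟦(1 : ℤ)⟧') : a = b :=
    (DerivedCategory.singleFunctor A 0).map_injective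
      ((shiftFunctor (DerivedCategory A) (-2 : ℤ)).map_injective (eq_of_mor₃_comp_shift_eq h hYX hab))
  have exist (φ : V ⟶ V) : ∃ (g₀ : A₀ ⟶ A₀) (g₁ : A₁ ⟶ A₁),
      i ≫ φ = (DerivedCategory.singleFunctor A 0).map g₀ ≫ i ∧
      φ ≫ p = p ≫ (((DerivedCategory.singleFunctor A 0).map g₁)⟦(-2 : ℤ)⟧')⟦(1 : ℤ)⟧' ∧
      e ≫ (DerivedCategory.singleFunctor A 0).map g₀ =
        ((DerivedCategory.singleFunctor A 0).map g₁)⟦(-2 : ℤ)⟧' ≫ e := by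
    obtain ⟨b, a, hb, ha, hab⟩ := exists_triangle_endomorphism_of_hom₃ h hYX₁ φ
    obtain ⟨g₀, rfl⟩ := (DerivedCategory.singleFunctor A 0).map_surjective b
    obtain ⟨a, rfl⟩ := (shiftFunctor (DerivedCategory A) (-2 : ℤ)).map_surjective a
    obtain ⟨g₁, rfl⟩ := (DerivedCategory.singleFunctor A 0).map_surjective a
    exact ⟨g₀, g₁, hb, ha, hab⟩
  have comp₀ {φ ψ : V ⟶ V} {a b : A₀ ⟶ A₀} (hφψ : φ ≫ ψ = 𝟙 V)
      (ha : i ≫ φ = (DerivedCategory.singleFunctor A 0).map a ≫ i)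
      (hb : i ≫ ψ = (DerivedCategory.singleFunctor A 0).map b ≫ i) : a ≫ b = 𝟙 A₀ := by
    apply unique₀
    rw [Functor.map_comp, Category.assoc, ← hb, ← Category.assoc, ← ha, Category.assoc, hφψ]
    simp
  have comp₁ {φ ψ : V ⟶ V} {a b : A₁ ⟶ A₁} (hφψ : ψ ≫ φ = 𝟙 V)
      (ha : φ ≫ p = p ≫ (((DerivedCategory.singleFunctor A 0).map a)⟦(-2 : ℤ)⟧')⟦(1 : ℤ)⟧')
      (hb : ψ ≫ p = p ≫ (((DerivedCategory.singleFunctor A 0).map b)⟦(-2 : ℤ)⟧')⟦(1 : ℤ)⟧') :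
      b ≫ a = 𝟙 A₁ := by
    apply unique₁
    rw [Functor.map_comp, Functor.map_comp, Functor.map_comp, ← Category.assoc, ← hb,
      Category.assoc, ← ha, ← Category.assoc, hφψ]
    simp
  refine ⟨fun φ ↦ ⟨?_, fun g₀ g₁ h₀ h₁ ↦ ?_⟩, fun g₀ g₁ hg ↦ ?_⟩
  · obtain ⟨g₀, g₁, h₀, h₁, -⟩ := exist φ.hom
    exact ⟨(g₀, g₁), ⟨h₀, h₁⟩, fun g hg ↦
      Prod.ext (unique₀ (hg.1.symm.trans h₀)) (unique₁ (hg.2.symm.trans h₁))⟩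
  · obtain ⟨g₀', g₁', h₀', h₁', hg⟩ := exist φ.hom
    obtain rfl : g₀ = g₀' := unique₀ (h₀.symm.trans h₀')
    obtain rfl : g₁ = g₁' := unique₁ (h₁.symm.trans h₁')
    obtain ⟨k₀, k₁, hk₀, hk₁, -⟩ := exist φ.inv
    exact ⟨⟨k₀, comp₀ φ.hom_inv_id h₀ hk₀, comp₀ φ.inv_hom_id hk₀ h₀⟩,
      ⟨k₁, comp₁ φ.hom_inv_id hk₁ h₁, comp₁ φ.inv_hom_id h₁ hk₁⟩, hg⟩
  · let ε := isoTriangleOfIso₁₂ _ _ h h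
      ((shiftFunctor (DerivedCategory A) (-2 : ℤ)).mapIso
        ((DerivedCategory.singleFunctor A 0).mapIso g₁))
      ((DerivedCategory.singleFunctor A 0).mapIso g₀) hg
    exact ⟨Triangle.π₃.mapIso ε, ε.hom.comm₂, ε.hom.comm₃.symm⟩
end
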